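/- arXiv:1008.0841 — 2 statements merged into one kernel-verified Lean document; each statement's English description precedes it below -/
import Mathlib

section
/- Let $0 < \alpha < 1$, $G$ be $C^1$ on $[a,b]^2$ with $G(s,s)\neq 0$ for all $s$, and $f$ continuous on $[a,b]$. Then the generalized Abel equation $\int_a^s \frac{G(s,t)}{(s-t)^{\alpha}}\varphi(t)\,dt = f(s)$ has at most one continuous solution $\varphi$ on $[a,b]$. -/
open MeasureTheory Set intervalIntegral
open Filter Topology

theorem abs_diag_mul_le_of_volterra_eq_zero {a b : ℝ} {C : NNReal} {K : ℝ → ℝ → ℝ}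
    (hK : LipschitzWith C (fun p : ℝ × ℝ => K p.1 p.2)) {h : ℝ → ℝ} (hh : Continuous h)
    (heq : ∀ x ∈ Icc a b, ∫ t in a..x, K x t * h t = 0) {x : ℝ} (hx : x ∈ Ico a b) :
    |K x x * h x| ≤ C * ∫ t in a..x, |h t| := by
  have hKc (y : ℝ) : Continuous (fun t => K y t * h t) :=
    (hK.continuous.comp (by fun_prop : Continuous fun t : ℝ => (y, t))).mul hh
  have hderiv : HasDerivAt (fun y => ∫ t in a..y, K x t * h t) (K x x * h x) x :=
    integral_hasDerivAt_right ((hKc x).intervalIntegrable _ _)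
      (hKc x).aestronglyMeasurable.stronglyMeasurableAtFilter (hKc x).continuousAt
  have hslope := (hasDerivWithinAt_iff_tendsto_slope' (by simp)).1
    (hderiv.hasDerivWithinAt (s := Ioi x))
  have hprim : Tendsto (fun y => C * ∫ t in a..y, |h t|) (𝓝[>] x)
      (𝓝 (C * ∫ t in a..x, |h t|)) := by
    have : Continuous fun y => C * ∫ t in a..y, |h t| :=
      continuous_const.mul (continuous_primitive (fun u v => hh.abs.intervalIntegrable u v) a)
    exact this.continuousAt.tendsto.mono_left nhdsWithin_le_nhds
  refine le_of_tendsto_of_tendsto hslope.abs hprim ?_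
  filter_upwards [Ioc_mem_nhdsGT hx.2] with y hy
  have hxy : 0 < y - x := sub_pos.2 hy.1
  have hay : a ≤ y := hx.1.trans hy.1.le
  rw [slope_def_field, heq x ⟨hx.1, hx.2.le⟩, sub_zero, abs_div, abs_of_pos hxy, div_le_iff₀ hxy]
  have hdiff : ∫ t in a..y, K x t * h t = ∫ t in a..y, (K x t * h t - K y t * h t) := by
    rw [integral_sub ((hKc x).intervalIntegrable _ _) ((hKc y).intervalIntegrable _ _),
      heq y ⟨hay, hy.2⟩, sub_zero]
  rw [hdiff, ← Real.norm_eq_abs]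
  calc ‖∫ t in a..y, (K x t * h t - K y t * h t)‖
      ≤ ∫ t in a..y, C * (y - x) * |h t| := by
        refine norm_integral_le_of_norm_le hay (ae_of_all _ fun t _ => ?_)
          ((hh.abs.const_mul _).intervalIntegrable _ _)
        rw [← sub_mul, norm_mul, Real.norm_eq_abs, Real.norm_eq_abs]
        refine mul_le_mul_of_nonneg_right ?_ (abs_nonneg _)
        have := hK.dist_le_mul (x, t) (y, t)
        simpa [Prod.dist_eq, Real.dist_eq, abs_sub_comm x y, abs_of_pos hxy, hxy.le] using this
    _ = C * (∫ t in a..y, |h t|) * (y - x) := by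
        rw [intervalIntegral.integral_const_mul]; ring

theorem eq_zero_of_volterra_eq_zero {a b : ℝ} (hab : a < b) {C : NNReal} {K : ℝ → ℝ → ℝ}
    (hK : LipschitzWith C (fun p : ℝ × ℝ => K p.1 p.2)) {h : ℝ → ℝ} (hh : Continuous h)
    (hdiag : ∀ s ∈ Icc a b, K s s ≠ 0)
    (heq : ∀ x ∈ Icc a b, ∫ t in a..x, K x t * h t = 0) : ∀ x ∈ Icc a b, h x = 0 := by
  have hKd : Continuous fun s => |K s s| :=
    (hK.continuous.comp (by fun_prop : Continuous fun s : ℝ => (s, s))).abs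
  obtain ⟨s₀, hs₀, hmin⟩ := isCompact_Icc.exists_isMinOn (nonempty_Icc.2 hab.le) hKd.continuousOn
  have hm : 0 < |K s₀ s₀| := abs_pos.2 (hdiag s₀ hs₀)
  have hpos (x : ℝ) (hx : a ≤ x) : 0 ≤ ∫ t in a..x, |h t| :=
    integral_nonneg hx fun _ _ => abs_nonneg _
  have hbound (x : ℝ) (hx : x ∈ Ico a b) :
      |h x| ≤ C / |K s₀ s₀| * ∫ t in a..x, |h t| := by
    have h1 := abs_diag_mul_le_of_volterra_eq_zero hK hh heq hx
    have h2 : |K s₀ s₀| ≤ |K x x| := hmin (Ico_subset_Icc_self hx)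
    rw [abs_mul] at h1
    rw [div_mul_eq_mul_div, le_div_iff₀ hm, mul_comm]
    exact (mul_le_mul_of_nonneg_right h2 (abs_nonneg _)).trans h1
  have hzero : ∀ x ∈ Icc a b, ∫ t in a..x, |h t| = 0 := by
    refine eq_zero_of_abs_deriv_le_mul_abs_self_of_eq_zero_right (f' := fun x => |h x|)
      (K := C / |K s₀ s₀|)
      (continuous_primitive (fun u v => hh.abs.intervalIntegrable u v) a).continuousOn
      (fun x _ => (integral_hasDerivAt_right (hh.abs.intervalIntegrable _ _)
        hh.abs.aestronglyMeasurable.stronglyMeasurableAtFilter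
        hh.abs.continuousAt).hasDerivWithinAt) integral_same fun x hx => ?_
    rw [Real.norm_eq_abs, Real.norm_eq_abs, abs_abs, abs_of_nonneg (hpos x hx.1)]
    exact hbound x hx
  have hIco : EqOn h 0 (Ico a b) := fun x hx => by
    have := hbound x hx
    rw [hzero x (Ico_subset_Icc_self hx), mul_zero] at this
    exact abs_nonpos_iff.1 this
  rw [← closure_Ico hab.ne]
  exact hIco.closure hh continuous_zero

theorem intervalIntegrable_beta {u v : ℝ} (hu : 0 < u) (hv : 0 < v) :
    IntervalIntegrable (fun x : ℝ => x ^ (u - 1) * (1 - x) ^ (v - 1)) volume 0 1 := by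
  have := Complex.betaIntegral_convergent (u := u) (v := v) (by simpa) (by simpa)
  rw [intervalIntegrable_iff_integrableOn_Ioc_of_le zero_le_one] at this ⊢
  refine (IntegrableOn.congr_fun this.norm (fun x hx => ?_) measurableSet_Ioc)
  have h1 : (0 : ℝ) ≤ 1 - x := by linarith [hx.2]
  have e1 : ((x : ℂ) ^ ((u : ℂ) - 1)) = ((x ^ (u - 1) : ℝ) : ℂ) := by
    rw [Complex.ofReal_cpow hx.1.le]; simp
  have e2 : ((1 - x : ℂ) ^ ((v : ℂ) - 1)) = (((1 - x) ^ (v - 1) : ℝ) : ℂ) := by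
    rw [Complex.ofReal_cpow h1]; simp
  simp only [e1, e2, norm_mul, Complex.norm_real, Real.norm_eq_abs]
  rw [abs_of_nonneg (Real.rpow_nonneg hx.1.le _), abs_of_nonneg (Real.rpow_nonneg h1 _)]

/-- The kernel obtained from the Abel kernel `G s t / (s - t) ^ α` by composing with
`(x - s) ^ (α - 1)`. -/
noncomputable def abelKernel (α : ℝ) (G : ℝ → ℝ → ℝ) (x t : ℝ) : ℝ :=
  ∫ u in (0 : ℝ)..1, u ^ (-α) * (1 - u) ^ (α - 1) * G (t + (x - t) * u) t

theorem intervalIntegrable_abelWeight {α : ℝ} (hα : 0 < α) (hα1 : α < 1) :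
    IntervalIntegrable (fun u : ℝ => u ^ (-α) * (1 - u) ^ (α - 1)) volume 0 1 := by
  simpa [show 1 - α - 1 = -α by ring] using intervalIntegrable_beta (sub_pos.2 hα1) hα

theorem abelKernel_self_ne_zero {α : ℝ} (hα : 0 < α) (hα1 : α < 1) {G : ℝ → ℝ → ℝ} {s : ℝ}
    (hs : G s s ≠ 0) : abelKernel α G s s ≠ 0 := by
  have hpos : 0 < ∫ u in (0 : ℝ)..1, u ^ (-α) * (1 - u) ^ (α - 1) :=
    intervalIntegral_pos_of_pos_on (intervalIntegrable_abelWeight hα hα1)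
      (fun u hu => mul_pos (Real.rpow_pos_of_pos hu.1 _)
        (Real.rpow_pos_of_pos (sub_pos.2 hu.2) _)) zero_lt_one
  simpa [abelKernel, intervalIntegral.integral_mul_const, hs] using hpos.ne'

theorem lipschitzWith_abelKernel {α : ℝ} (hα : 0 < α) (hα1 : α < 1) {G : ℝ → ℝ → ℝ} {C : NNReal}
    (hG : LipschitzWith C (fun p : ℝ × ℝ => G p.1 p.2)) :
    ∃ C' : NNReal, LipschitzWith C' (fun p : ℝ × ℝ => abelKernel α G p.1 p.2) := by
  have hw := intervalIntegrable_abelWeight hα hα1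
  have hint (x t : ℝ) : IntervalIntegrable
      (fun u : ℝ => u ^ (-α) * (1 - u) ^ (α - 1) * G (t + (x - t) * u) t) volume 0 1 :=
    hw.mul_continuousOn (hG.continuous.comp
      (by fun_prop : Continuous fun u : ℝ => (t + (x - t) * u, t))).continuousOn
  set c : ℝ := ∫ u in (0 : ℝ)..1, u ^ (-α) * (1 - u) ^ (α - 1)
  have key (p q : ℝ × ℝ) :
      dist (abelKernel α G p.1 p.2) (abelKernel α G q.1 q.2) ≤ C * c * dist p q := by
    rw [Real.dist_eq, abelKernel, abelKernel, ← integral_sub (hint _ _) (hint _ _),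
      ← Real.norm_eq_abs]
    calc _ ≤ ∫ u in (0 : ℝ)..1, u ^ (-α) * (1 - u) ^ (α - 1) * (C * dist p q) := by
          refine norm_integral_le_of_norm_le zero_le_one (ae_of_all _ fun u hu => ?_)
            (hw.mul_const _)
          have hu1 : 0 ≤ 1 - u := sub_nonneg.2 hu.2
          have hw0 : 0 ≤ u ^ (-α) * (1 - u) ^ (α - 1) :=
            mul_nonneg (Real.rpow_nonneg hu.1.le _) (Real.rpow_nonneg hu1 _)
          rw [← mul_sub, norm_mul, Real.norm_of_nonneg hw0]
          refine mul_le_mul_of_nonneg_left ?_ hw0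
          refine (hG.dist_le_mul (p.2 + (p.1 - p.2) * u, p.2) (q.2 + (q.1 - q.2) * u, q.2)).trans
            (mul_le_mul_of_nonneg_left ?_ C.coe_nonneg)
          have h1 : |p.1 - q.1| ≤ dist p q := le_max_left _ _
          have h2 : |p.2 - q.2| ≤ dist p q := le_max_right _ _
          refine max_le ?_ h2
          calc |p.2 + (p.1 - p.2) * u - (q.2 + (q.1 - q.2) * u)|
              = |(p.1 - q.1) * u + (p.2 - q.2) * (1 - u)| := by congr 1; ring
            _ ≤ |p.1 - q.1| * u + |p.2 - q.2| * (1 - u) := by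
                refine (abs_add_le _ _).trans_eq ?_
                rw [abs_mul, abs_mul, abs_of_nonneg hu.1.le, abs_of_nonneg hu1]
            _ ≤ dist p q * u + dist p q * (1 - u) := by
                gcongr
                exact hu.1.le
            _ = dist p q := by ring
      _ = C * c * dist p q := by
          rw [intervalIntegral.integral_mul_const]; ring
  refine ⟨C * c.toNNReal, LipschitzWith.of_dist_le_mul fun p q => (key p q).trans ?_⟩
  push_cast
  gcongr
  exact Real.le_coe_toNNReal c

theorem integral_abel_eq_abelKernel {α : ℝ} (G : ℝ → ℝ → ℝ) {x t : ℝ} (htx : t < x) :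
    ∫ s in t..x, (x - s) ^ (α - 1) * (s - t) ^ (-α) * G s t = abelKernel α G x t := by
  have hxt : 0 < x - t := sub_pos.2 htx
  have h := smul_integral_comp_mul_add (a := 0) (b := 1)
    (fun s => (x - s) ^ (α - 1) * (s - t) ^ (-α) * G s t) (x - t) t
  simp only [mul_zero, zero_add, mul_one, sub_add_cancel] at h
  rw [← h, smul_eq_mul, ← intervalIntegral.integral_const_mul, abelKernel]
  refine integral_congr fun u hu => ?_
  rw [uIcc_of_le zero_le_one] at hu
  have e : (x - t) * ((x - t) ^ (α - 1) * (x - t) ^ (-α)) = 1 := by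
    rw [← Real.rpow_add hxt, show α - 1 + -α = -1 by ring, Real.rpow_neg_one,
      mul_inv_cancel₀ hxt.ne']
  rw [show x - ((x - t) * u + t) = (x - t) * (1 - u) by ring,
    show (x - t) * u + t - t = (x - t) * u by ring,
    Real.mul_rpow hxt.le (sub_nonneg.2 hu.2), Real.mul_rpow hxt.le hu.1, add_comm ((x - t) * u)]
  linear_combination (u ^ (-α) * (1 - u) ^ (α - 1) * G (t + (x - t) * u) t) * e

theorem integrable_abel_prod {a x α : ℝ} (hα : 0 < α) (hα1 : α < 1) (hax : a ≤ x)
    {g : ℝ → ℝ → ℝ} (hg : Continuous fun p : ℝ × ℝ => g p.1 p.2) :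
    Integrable (fun p : ℝ × ℝ => (Iio p.2).indicator
      (fun t => (x - p.2) ^ (α - 1) * (p.2 - t) ^ (-α) * g p.2 t) p.1)
      ((volume.restrict (Ioo a x)).prod (volume.restrict (Ioo a x))) := by
  have hf : Integrable ((Ioo a x).indicator fun s => (x - s) ^ (α - 1)) := by
    rw [integrable_indicator_iff measurableSet_Ioo,
      ← intervalIntegrable_iff_integrableOn_Ioo_of_le hax]
    simpa using ((intervalIntegrable_rpow' (a := x - a) (b := x - x) (r := α - 1)
      (by linarith)).comp_sub_left x)
  have hk : Integrable ((Ioo (a - x) 0).indicator fun v => (-v) ^ (-α)) := by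
    rw [integrable_indicator_iff measurableSet_Ioo,
      ← intervalIntegrable_iff_integrableOn_Ioo_of_le (by linarith)]
    simpa using ((intervalIntegrable_rpow' (a := 0 - (a - x)) (b := 0 - 0) (r := -α)
      (by linarith)).comp_sub_left 0)
  have hconv := (hf.convolution_integrand (ContinuousLinearMap.mul ℝ ℝ) hk).mono_measure
    (Measure.restrict_le_self (s := Ioo a x ×ˢ Ioo a x))
  have hgs : Continuous fun p : ℝ × ℝ => g p.2 p.1 := hg.comp continuous_swap
  obtain ⟨M, hM⟩ := (isCompact_Icc.prod isCompact_Icc :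
    IsCompact (Icc a x ×ˢ Icc a x)).exists_bound_of_continuousOn hgs.continuousOn
  have hmem : ∀ᵐ p : ℝ × ℝ ∂(volume.prod volume).restrict (Ioo a x ×ˢ Ioo a x),
      p ∈ Ioo a x ×ˢ Ioo a x :=
    ae_restrict_mem (measurableSet_Ioo.prod measurableSet_Ioo)
  rw [Measure.prod_restrict]
  refine (hconv.mul_bdd (c := M) hgs.aestronglyMeasurable ?_).congr ?_
  · filter_upwards [hmem] with p hp
    exact hM p ⟨Ioo_subset_Icc_self hp.1, Ioo_subset_Icc_self hp.2⟩
  · filter_upwards [hmem] with p hp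
    obtain ⟨⟨h1, h2⟩, h3, h4⟩ := hp
    by_cases hlt : p.1 < p.2
    · have : p.1 - p.2 ∈ Ioo (a - x) 0 := ⟨by linarith, by linarith⟩
      simp [indicator_of_mem this, indicator_of_mem (show p.2 ∈ Ioo a x from ⟨h3, h4⟩), hlt]
    · simp [hlt]

theorem integral_abelKernel_mul_eq_zero {a x α : ℝ} (hα : 0 < α) (hα1 : α < 1) (hax : a ≤ x)
    {G : ℝ → ℝ → ℝ} (hG : Continuous fun p : ℝ × ℝ => G p.1 p.2) {h : ℝ → ℝ} (hh : Continuous h)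
    (heq : ∀ s ∈ Ioo a x, ∫ t in a..s, G s t / (s - t) ^ α * h t = 0) :
    ∫ t in a..x, abelKernel α G x t * h t = 0 := by
  have hswap := integral_integral_swap (f := fun t s => (Iio s).indicator
    (fun t => (x - s) ^ (α - 1) * (s - t) ^ (-α) * (G s t * h t)) t) (integrable_abel_prod hα hα1 hax
    (g := fun s t => G s t * h t) (hG.mul (hh.comp continuous_snd)))
  have hright : ∫ s in Ioo a x, ∫ t in Ioo a x, (Iio s).indicator
      (fun t => (x - s) ^ (α - 1) * (s - t) ^ (-α) * (G s t * h t)) t = 0 := by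
    refine setIntegral_eq_zero_of_forall_eq_zero fun s hs => ?_
    rw [setIntegral_indicator measurableSet_Iio, Ioo_inter_Iio, min_eq_right hs.2.le,
      ← integral_Ioc_eq_integral_Ioo, ← integral_of_le hs.1.le]
    calc _ = ∫ t in a..s, (x - s) ^ (α - 1) * (G s t / (s - t) ^ α * h t) := by
          refine integral_congr fun t ht => ?_
          rw [uIcc_of_le hs.1.le] at ht
          rw [Real.rpow_neg (sub_nonneg.2 ht.2)]
          ring
      _ = 0 := by rw [intervalIntegral.integral_const_mul, heq s hs, mul_zero]
  have hleft : ∫ t in Ioo a x, ∫ s in Ioo a x, (Iio s).indicator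
      (fun t => (x - s) ^ (α - 1) * (s - t) ^ (-α) * (G s t * h t)) t =
      ∫ t in Ioo a x, abelKernel α G x t * h t := by
    refine setIntegral_congr_fun measurableSet_Ioo fun t ht => ?_
    have hind : ∀ s, (Iio s).indicator
        (fun t => (x - s) ^ (α - 1) * (s - t) ^ (-α) * (G s t * h t)) t = (Ioi t).indicator
        (fun s => (x - s) ^ (α - 1) * (s - t) ^ (-α) * G s t * h t) s := fun s => by
      simp only [indicator, mem_Iio, mem_Ioi, mul_assoc]
    simp only [hind]
    rw [setIntegral_indicator measurableSet_Ioi, Ioo_inter_Ioi, max_eq_right ht.1.le,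
      ← integral_Ioc_eq_integral_Ioo, ← integral_of_le ht.2.le,
      intervalIntegral.integral_mul_const, integral_abel_eq_abelKernel G ht.2]
  rw [integral_of_le hax, integral_Ioc_eq_integral_Ioo, ← hleft]
  exact hswap.trans hright

theorem intervalIntegrable_abel {a s α : ℝ} (hα1 : α < 1) (has : a ≤ s) {g : ℝ → ℝ}
    (hg : Continuous g) : IntervalIntegrable (fun t => g t / (s - t) ^ α) volume a s := by
  have h : IntervalIntegrable (fun t => (s - t) ^ (-α)) volume a s := by
    simpa using ((intervalIntegrable_rpow' (a := s - a) (b := s - s) (r := -α)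
      (by linarith)).comp_sub_left s)
  refine (h.continuousOn_mul hg.continuousOn).congr fun t ht => ?_
  rw [uIoc_of_le has] at ht
  simp only [Real.rpow_neg (sub_nonneg.2 ht.2), div_eq_mul_inv]

/-- Uniqueness of continuous solutions of the generalized Abel integral equation. -/
theorem abel_uniqueness {a b : ℝ} (hab : a < b) (α : ℝ) (hα : 0 < α) (hα1 : α < 1)
    (G : ℝ → ℝ → ℝ)
    (hG : ContDiffOn ℝ 1 (fun p : ℝ × ℝ => G p.1 p.2) (Icc a b ×ˢ Icc a b))
    (hdiag : ∀ s ∈ Icc a b, G s s ≠ 0)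
    (f : ℝ → ℝ) (hf : ContinuousOn f (Icc a b))
    (φ ψ : ℝ → ℝ) (hφ : ContinuousOn φ (Icc a b)) (hψ : ContinuousOn ψ (Icc a b))
    (hφeq : ∀ s ∈ Icc a b, ∫ t in a..s, G s t / (s - t) ^ α * φ t = f s)
    (hψeq : ∀ s ∈ Icc a b, ∫ t in a..s, G s t / (s - t) ^ α * ψ t = f s) :
    EqOn φ ψ (Icc a b) := by
  obtain ⟨C, hC⟩ := hG.exists_lipschitzOnWith one_ne_zero
    ((convex_Icc a b).prod (convex_Icc a b)) (isCompact_Icc.prod isCompact_Icc)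
  let π : ℝ → ℝ := fun s => projIcc a b hab.le s
  have hπ : LipschitzWith 1 π := LipschitzWith.projIcc hab.le
  have hπmem (s : ℝ) : π s ∈ Icc a b := (projIcc a b hab.le s).2
  have hπeq {s : ℝ} (hs : s ∈ Icc a b) : π s = s := by simp [π, projIcc_of_mem hab.le hs]
  have hG' : LipschitzWith C (fun p : ℝ × ℝ => G (π p.1) (π p.2)) := by
    refine LipschitzWith.of_dist_le_mul fun p q => ?_
    refine (hC.dist_le_mul (π p.1, π p.2) ⟨hπmem _, hπmem _⟩ (π q.1, π q.2)
      ⟨hπmem _, hπmem _⟩).trans (mul_le_mul_of_nonneg_left ?_ C.coe_nonneg)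
    exact max_le_max (by simpa using hπ.dist_le_mul p.1 q.1)
      (by simpa using hπ.dist_le_mul p.2 q.2)
  have hcomp {χ : ℝ → ℝ} (hχ : ContinuousOn χ (Icc a b)) : Continuous fun t => χ (π t) :=
    hχ.comp_continuous hπ.continuous hπmem
  have hGt (s : ℝ) : Continuous fun t => G (π s) (π t) :=
    hG'.continuous.comp (by fun_prop : Continuous fun t : ℝ => (s, t))
  have hint {s : ℝ} (hs : s ∈ Icc a b) {χ : ℝ → ℝ} (hχ : ContinuousOn χ (Icc a b)) : IntervalIntegrable
      (fun t => G (π s) (π t) / (s - t) ^ α * χ (π t)) volume a s := by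
    simp only [div_mul_eq_mul_div]
    exact intervalIntegrable_abel hα1 hs.1 ((hGt s).mul (hcomp hχ))
  have hext {s : ℝ} (hs : s ∈ Icc a b) (χ : ℝ → ℝ) :
      ∫ t in a..s, G (π s) (π t) / (s - t) ^ α * χ (π t) =
        ∫ t in a..s, G s t / (s - t) ^ α * χ t := by
    refine integral_congr fun t ht => ?_
    rw [uIcc_of_le hs.1] at ht
    simp only [hπeq hs, hπeq ⟨ht.1, ht.2.trans hs.2⟩]
  have heq : ∀ s ∈ Icc a b,
      ∫ t in a..s, G (π s) (π t) / (s - t) ^ α * (φ (π t) - ψ (π t)) = 0 := fun s hs => by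
    simp only [mul_sub]
    rw [integral_sub (hint hs hφ) (hint hs hψ), hext hs, hext hs, hφeq s hs, hψeq s hs, sub_self]
  have hh : Continuous fun t => φ (π t) - ψ (π t) := (hcomp hφ).sub (hcomp hψ)
  obtain ⟨C', hC'⟩ := lipschitzWith_abelKernel hα hα1 (G := fun s t => G (π s) (π t)) hG'
  have hzero := eq_zero_of_volterra_eq_zero hab hC' hh
    (fun s hs => abelKernel_self_ne_zero hα hα1 (by simpa only [hπeq hs] using hdiag s hs))
    (fun x hx => integral_abelKernel_mul_eq_zero hα hα1 hx.1 hG'.continuous hh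
      fun s hs => heq s ⟨hs.1.le, hs.2.le.trans hx.2⟩)
  intro s hs
  simpa only [hπeq hs, sub_eq_zero] using hzero s hs
end

section
/- Let $F \in C([0,1])$ and $H \in C^\infty$ with $H(0) \neq 0$, and suppose $\int_0^s F(u)\,H((su-u^2)^{1/2})\,(su-u^2)^{-1/2}\,du = 0$ for all $s \in (0,1]$. Then $F \equiv 0$ on $[0,1]$. -/
open MeasureTheory Set intervalIntegral Real

lemma image_sin_sq_Ioo {a b : ℝ} (hab : a < b) :
    (fun θ : ℝ => a + (b - a) * sin θ ^ 2) '' Ioo 0 (π / 2) = Ioo a b := by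
  ext s
  simp only [mem_image, mem_Ioo]
  constructor
  · rintro ⟨θ, ⟨h0, h1⟩, rfl⟩
    have hs : 0 < sin θ := sin_pos_of_pos_of_lt_pi h0 (by linarith [pi_pos])
    have hc : 0 < cos θ := cos_pos_of_mem_Ioo ⟨by linarith, h1⟩
    have := sin_sq_add_cos_sq θ
    constructor
    · nlinarith [mul_pos (sub_pos.2 hab) (pow_pos hs 2)]
    · nlinarith [mul_pos (sub_pos.2 hab) (pow_pos hc 2)]
  · rintro ⟨h0, h1⟩
    have hba : 0 < b - a := sub_pos.2 hab
    have hr0 : 0 < (s - a) / (b - a) := div_pos (by linarith) hba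
    have hr1 : (s - a) / (b - a) < 1 := (div_lt_one hba).2 (by linarith)
    refine ⟨arcsin √((s - a) / (b - a)), ⟨arcsin_pos.2 (sqrt_pos.2 hr0), ?_⟩, ?_⟩
    · rw [arcsin_lt_pi_div_two, sqrt_lt' one_pos]; simpa using hr1
    · rw [sin_arcsin (by linarith [sqrt_nonneg ((s - a) / (b - a))])
        (sqrt_le_one.2 hr1.le), sq_sqrt hr0.le]
      field_simp; ring

lemma hasDerivAt_sin_sq_subst (a b θ : ℝ) :
    HasDerivAt (fun θ : ℝ => a + (b - a) * sin θ ^ 2) ((b - a) * (2 * sin θ * cos θ)) θ := by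
  refine ((((hasDerivAt_sin θ).fun_pow 2).const_mul (b - a)).const_add a).congr_deriv ?_
  push_cast
  ring

lemma injOn_sin_sq_subst {a b : ℝ} (hab : a < b) :
    InjOn (fun θ : ℝ => a + (b - a) * sin θ ^ 2) (Ioo 0 (π / 2)) := by
  intro x hx y hy h
  have hba : b - a ≠ 0 := (sub_pos.2 hab).ne'
  have h2 : sin x ^ 2 = sin y ^ 2 := by simpa [hba] using h
  have hpos : ∀ z ∈ Ioo 0 (π / 2), 0 ≤ sin z := fun z hz =>
    sin_nonneg_of_nonneg_of_le_pi hz.1.le (by linarith [hz.2, pi_pos])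
  have h3 : sin x = sin y := by
    rwa [sq_eq_sq₀ (hpos x hx) (hpos y hy)] at h2
  exact injOn_sin ⟨by linarith [hx.1, pi_pos], hx.2.le⟩ ⟨by linarith [hy.1, pi_pos], hy.2.le⟩ h3

lemma abs_deriv_sin_sq_subst_smul {a b θ : ℝ} (hab : a < b) (hθ : θ ∈ Ioo 0 (π / 2)) (h : ℝ → ℝ) :
    |(b - a) * (2 * sin θ * cos θ)| • (h (a + (b - a) * sin θ ^ 2) *
      ((√(a + (b - a) * sin θ ^ 2 - a))⁻¹ * (√(b - (a + (b - a) * sin θ ^ 2)))⁻¹)) =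
    2 * h (a + (b - a) * sin θ ^ 2) := by
  have hs : 0 < sin θ := sin_pos_of_pos_of_lt_pi hθ.1 (by linarith [pi_pos, hθ.2])
  have hc : 0 < cos θ := cos_pos_of_mem_Ioo ⟨by linarith [hθ.1, pi_pos], hθ.2⟩
  have hba : 0 < b - a := sub_pos.2 hab
  have e1 : √(a + (b - a) * sin θ ^ 2 - a) = √(b - a) * sin θ := by
    rw [add_sub_cancel_left, sqrt_mul hba.le, sqrt_sq hs.le]
  have e2 : √(b - (a + (b - a) * sin θ ^ 2)) = √(b - a) * cos θ := by
    rw [show b - (a + (b - a) * sin θ ^ 2) = (b - a) * cos θ ^ 2 by rw [cos_sq']; ring,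
      sqrt_mul hba.le, sqrt_sq hc.le]
  rw [e1, e2, abs_of_pos (by positivity), smul_eq_mul]
  have h1 : √(b - a) ≠ 0 := (sqrt_pos.2 hba).ne'
  have h2 : √(b - a) ^ 2 = b - a := sq_sqrt hba.le
  field_simp
  rw [h2, mul_comm]

/-- The substitution `s = a + (b - a) sin² θ` against the weight `1 / √((s - a) (b - s))`. -/
lemma setIntegral_mul_inv_sqrt {a b : ℝ} (hab : a < b) (h : ℝ → ℝ) :
    ∫ s in Ioo a b, h s * ((√(s - a))⁻¹ * (√(b - s))⁻¹) =
      2 * ∫ θ in (0 : ℝ)..π / 2, h (a + (b - a) * sin θ ^ 2) := by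
  rw [← image_sin_sq_Ioo hab, integral_image_eq_integral_abs_deriv_smul measurableSet_Ioo
    (fun θ _ => (hasDerivAt_sin_sq_subst a b θ).hasDerivWithinAt) (injOn_sin_sq_subst hab),
    setIntegral_congr_fun measurableSet_Ioo
      (fun θ hθ => abs_deriv_sin_sq_subst_smul hab hθ h),
    integral_of_le (by positivity), integral_Ioc_eq_integral_Ioo,
    MeasureTheory.integral_const_mul]

lemma integrableOn_mul_inv_sqrt {a b : ℝ} (hab : a < b) {h : ℝ → ℝ} (hh : Continuous h) :
    IntegrableOn (fun s => h s * ((√(s - a))⁻¹ * (√(b - s))⁻¹)) (Ioo a b) := by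
  rw [← image_sin_sq_Ioo hab, integrableOn_image_iff_integrableOn_abs_deriv_smul measurableSet_Ioo
    (fun θ _ => (hasDerivAt_sin_sq_subst a b θ).hasDerivWithinAt) (injOn_sin_sq_subst hab),
    integrableOn_congr_fun (fun θ hθ => abs_deriv_sin_sq_subst_smul hab hθ h) measurableSet_Ioo]
  exact ((by fun_prop : Continuous fun θ : ℝ =>
    2 * h (a + (b - a) * sin θ ^ 2)).integrableOn_Icc).mono_set Ioo_subset_Icc_self

lemma hasDerivAt_sqrt_sub_sqrt {t u : ℝ} (hu : u ∈ Ioo 0 t) :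
    HasDerivAt (fun u => 2 * √u - 2 * √(t - u)) ((√u)⁻¹ + (√(t - u))⁻¹) u := by
  have h1 := (hasDerivAt_sqrt hu.1.ne').const_mul 2
  have h2 := (((hasDerivAt_id' u).const_sub t).sqrt (sub_pos.2 hu.2).ne').const_mul 2
  refine (h1.fun_sub h2).congr_deriv ?_
  have a1 : √u ≠ 0 := (sqrt_pos.2 hu.1).ne'
  have a2 : √(t - u) ≠ 0 := (sqrt_pos.2 (sub_pos.2 hu.2)).ne'
  field_simp
  ring

lemma intervalIntegrable_inv_sqrt_add {a t : ℝ} (ha : 0 ≤ a) (hat : a ≤ t) :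
    IntervalIntegrable (fun u => (√u)⁻¹ + (√(t - u))⁻¹) volume a t := by
  refine intervalIntegrable_deriv_of_nonneg (g := fun u => 2 * √u - 2 * √(t - u))
    (by fun_prop) (fun u hu => ?_) (fun u _ => by positivity)
  rw [min_eq_left hat, max_eq_right hat] at hu
  exact hasDerivAt_sqrt_sub_sqrt ⟨ha.trans_lt hu.1, hu.2⟩

lemma integral_inv_sqrt_add_le {a t : ℝ} (ha : 0 ≤ a) (hat : a ≤ t) :
    ∫ u in a..t, ((√u)⁻¹ + (√(t - u))⁻¹) ≤ 4 * √(t - a) := by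
  rw [integral_eq_sub_of_hasDerivAt_of_le hat (f := fun u => 2 * √u - 2 * √(t - u))
    (by fun_prop) (fun u hu => hasDerivAt_sqrt_sub_sqrt ⟨ha.trans_lt hu.1, hu.2⟩)
    (intervalIntegrable_inv_sqrt_add ha hat)]
  have : √t ≤ √a + √(t - a) := by
    refine sqrt_le_iff.2 ⟨by positivity, ?_⟩
    nlinarith [sq_sqrt ha, sq_sqrt (sub_nonneg.2 hat), mul_nonneg (sqrt_nonneg a) (sqrt_nonneg (t - a))]
  simp only [sub_self, sqrt_zero]
  linarith

lemma eqOn_zero_step {P : ℝ → ℝ} {K a b : ℝ} (hP : Continuous P) (hK : 0 ≤ K)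
    (ha : 0 ≤ a) (hab : a ≤ b) (hb : b ≤ 1) (hsmall : K * (4 * √(b - a)) < 1)
    (hbound : ∀ t ∈ Ioc (0 : ℝ) 1, |P t| ≤ K * ∫ u in (0 : ℝ)..t, |P u| * ((√u)⁻¹ + (√(t - u))⁻¹))
    (hPa : ∀ t ∈ Icc 0 a, P t = 0) : ∀ t ∈ Icc 0 b, P t = 0 := by
  obtain ⟨m, hm, hmax⟩ := isCompact_Icc.exists_isMaxOn (nonempty_Icc.2 (ha.trans hab))
    (f := fun t => |P t|) (s := Icc 0 b) (by fun_prop)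
  suffices hPm : P m = 0 by
    intro t ht
    have := hmax ht
    simp only [hPm, abs_zero, mem_ofPred_eq] at this
    exact abs_nonpos_iff.1 this
  rcases le_total m a with hma | ham
  · exact hPa m ⟨hm.1, hma⟩
  rcases hm.1.eq_or_lt with h0 | h0
  · exact hPa m ⟨hm.1, h0 ▸ ha⟩
  have hint : ∀ c ∈ Icc 0 m, IntervalIntegrable (fun u => |P u| * ((√u)⁻¹ + (√(m - u))⁻¹))
      volume c m := fun c hc =>
    (intervalIntegrable_inv_sqrt_add hc.1 hc.2).continuousOn_mul hP.abs.continuousOn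
  have h1 := hbound m ⟨h0, hm.2.trans hb⟩
  have hsplit : ∫ u in (0 : ℝ)..m, |P u| * ((√u)⁻¹ + (√(m - u))⁻¹) =
      ∫ u in a..m, |P u| * ((√u)⁻¹ + (√(m - u))⁻¹) := by
    rw [← integral_add_adjacent_intervals (b := a) _ (hint a ⟨ha, ham⟩),
      integral_congr (g := fun _ => 0) _]
    · simp
    · intro u hu
      rw [uIcc_of_le ha] at hu
      simp [hPa u hu]
    · exact (hint 0 ⟨le_rfl, hm.1⟩).mono_set (by
        rw [uIcc_of_le ha, uIcc_of_le hm.1]; exact Icc_subset_Icc_right ham)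
  have h2 : ∫ u in a..m, |P u| * ((√u)⁻¹ + (√(m - u))⁻¹) ≤ |P m| * (4 * √(m - a)) := by
    calc _ ≤ ∫ u in a..m, |P m| * ((√u)⁻¹ + (√(m - u))⁻¹) := by
          refine integral_mono_on ham (hint a ⟨ha, ham⟩)
            ((intervalIntegrable_inv_sqrt_add ha ham).const_mul _) fun u hu => ?_
          exact mul_le_mul_of_nonneg_right (hmax ⟨ha.trans hu.1, hu.2.trans hm.2⟩) (by positivity)
      _ ≤ _ := by
          rw [intervalIntegral.integral_const_mul]
          exact mul_le_mul_of_nonneg_left (integral_inv_sqrt_add_le ha ham) (abs_nonneg _)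
  have h3 : √(m - a) ≤ √(b - a) := sqrt_le_sqrt (by linarith [hm.2])
  rw [hsplit] at h1
  have h4 : |P m| ≤ |P m| * (K * (4 * √(b - a))) := by
    calc |P m| ≤ K * (|P m| * (4 * √(m - a))) := h1.trans (by gcongr)
      _ ≤ K * (|P m| * (4 * √(b - a))) := by gcongr
      _ = _ := by ring
  by_contra hne
  have : 0 < |P m| := abs_pos.2 hne
  nlinarith

lemma eqOn_zero_of_abs_le {P : ℝ → ℝ} {K : ℝ} (hP : Continuous P) (hK : 0 ≤ K) (hP0 : P 0 = 0)
    (hbound : ∀ t ∈ Ioc (0 : ℝ) 1,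
      |P t| ≤ K * ∫ u in (0 : ℝ)..t, |P u| * ((√u)⁻¹ + (√(t - u))⁻¹)) :
    ∀ t ∈ Icc (0 : ℝ) 1, P t = 0 := by
  obtain ⟨δ, hδ, hKδ⟩ : ∃ δ > 0, K * (4 * √δ) < 1 := by
    refine ⟨(1 / (4 * (K + 1))) ^ 2, by positivity, ?_⟩
    rw [sqrt_sq (by positivity)]
    field_simp
    linarith
  have key : ∀ k : ℕ, ∀ t ∈ Icc 0 (min (k * δ) 1), P t = 0 := by
    intro k
    induction k with
    | zero =>
      intro t ht
      have : t = 0 := le_antisymm (by simpa using ht.2) ht.1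
      rw [this, hP0]
    | succ k ih =>
      refine eqOn_zero_step hP hK (by positivity) (min_le_min_right _ ?_) (min_le_right _ _) ?_
        hbound ih
      · push_cast; linarith
      · refine lt_of_le_of_lt ?_ hKδ
        gcongr
        rcases le_total (k * δ) 1 with h | h
        · rw [min_eq_left h]
          have := min_le_left (((k + 1 : ℕ) : ℝ) * δ) 1
          push_cast at this ⊢
          linarith
        · rw [min_eq_right h]
          have := min_le_right (((k + 1 : ℕ) : ℝ) * δ) 1
          linarith
  obtain ⟨k, hk⟩ := exists_nat_gt (1 / δ)
  have hk' : 1 ≤ k * δ := by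
    rw [div_lt_iff₀ hδ] at hk; exact hk.le
  simpa [min_eq_right hk'] using key k

lemma hasDerivAt_integral_comp_mul_sin {H : ℝ → ℝ} (hH : ContDiff ℝ 1 H) (y : ℝ) :
    HasDerivAt (fun y => ∫ θ in (0 : ℝ)..π / 2, H (y * sin θ))
      (∫ θ in (0 : ℝ)..π / 2, deriv H (y * sin θ) * sin θ) y := by
  have hH' : Continuous (deriv H) := hH.continuous_deriv le_rfl
  have hHc : Continuous H := hH.continuous
  obtain ⟨C, hC⟩ := (isCompact_Icc (a := -(|y| + 1)) (b := |y| + 1)).exists_bound_of_continuousOn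
    hH'.continuousOn
  refine (intervalIntegral.hasDerivAt_integral_of_dominated_loc_of_deriv_le
    (F := fun y θ => H (y * sin θ)) (F' := fun y θ => deriv H (y * sin θ) * sin θ)
    (bound := fun _ => C) (s := Metric.ball y 1) (Metric.ball_mem_nhds y one_pos)
    (.of_forall fun z => (by fun_prop : Continuous fun θ : ℝ => H (z * sin θ)).aestronglyMeasurable)
    ((by fun_prop : Continuous fun θ : ℝ => H (y * sin θ)).intervalIntegrable _ _)
    (by fun_prop : Continuous fun θ : ℝ => deriv H (y * sin θ) * sin θ).aestronglyMeasurable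
    (.of_forall fun θ _ z hz => ?_) (by simp) (.of_forall fun θ _ z _ => ?_)).2
  · have hz' : |z - y| < 1 := by simpa [Real.dist_eq] using hz
    have hzy : |z| ≤ |y| + 1 := by
      have := abs_add_le (z - y) y
      rw [sub_add_cancel] at this
      linarith
    have hle : |z * sin θ| ≤ |y| + 1 := by
      rw [abs_mul]
      calc |z| * |sin θ| ≤ |z| * 1 := by gcongr; exact abs_sin_le_one θ
        _ ≤ _ := by linarith
    have hCz := hC _ (abs_le.1 hle)
    rw [norm_mul]
    calc ‖deriv H (z * sin θ)‖ * ‖sin θ‖ ≤ C * 1 :=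
          mul_le_mul hCz (abs_sin_le_one θ) (norm_nonneg _) ((norm_nonneg _).trans hCz)
      _ = C := mul_one C
  · have h1 := (hH.differentiable one_ne_zero (z * sin θ)).hasDerivAt
    exact h1.comp z (hasDerivAt_mul_const (sin θ))

lemma intervalIntegrable_inv_sqrt (a b : ℝ) :
    IntervalIntegrable (fun u => (√u)⁻¹) volume a b := by
  have key : ∀ c : ℝ, IntervalIntegrable (fun u => (√u)⁻¹) volume 0 c := by
    intro c
    rcases le_total 0 c with hc | hc
    · refine intervalIntegrable_deriv_of_nonneg (g := fun u => 2 * √u)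
        (by fun_prop) (fun u hu => ?_) (fun u _ => by positivity)
      rw [min_eq_left hc, max_eq_right hc] at hu
      refine ((hasDerivAt_sqrt hu.1.ne').const_mul 2).congr_deriv ?_
      have a1 : √u ≠ 0 := (sqrt_pos.2 hu.1).ne'
      field_simp
    · refine (intervalIntegrable_const (c := (0 : ℝ))).congr fun u hu => ?_
      rw [uIoc_of_ge hc] at hu
      simp [sqrt_eq_zero_of_nonpos hu.2]
  exact (key a).symm.trans (key b)

/-- Integrating against `1 / √(t - s)` turns the kernel `H(√(u (s - u))) / √(u (s - u))` into
`N(√(u (t - u))) / √u`, where `N y = ∫ θ in 0..π / 2, H (y * sin θ)`. -/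
lemma setIntegral_abel_eq_zero {F H : ℝ → ℝ} (hF : Continuous F) (hH : Continuous H) {t : ℝ}
    (heq : ∀ s ∈ Ioo 0 t,
      ∫ u in Ioo 0 s, F u * (√u)⁻¹ * (H √(u * (s - u)) * (√(s - u))⁻¹) = 0) :
    ∫ u in Ioo 0 t, F u * (√u)⁻¹ * ∫ θ in (0 : ℝ)..π / 2, H (√(u * (t - u)) * sin θ) = 0 := by
  let g : ℝ → ℝ → ℝ := fun u s =>
    F u * (√u)⁻¹ * (H √(u * (s - u)) * ((√(s - u))⁻¹ * (√(t - s))⁻¹))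
  let Φ : ℝ → ℝ → ℝ := fun u => (Ioi u).indicator (g u)
  have hmeas : Measurable (Function.uncurry Φ) := by
    have hg : Measurable (Function.uncurry g) := by
      have := hF.measurable
      have := hH.measurable
      simp only [g, Function.uncurry_def]
      fun_prop
    exact hg.indicator (measurableSet_lt measurable_fst measurable_snd)
  have hcap : ∀ u ∈ Ioo 0 t, Ioo 0 t ∩ Ioi u = Ioo u t := by
    intro u hu
    ext s
    simp only [mem_inter_iff, mem_Ioo, mem_Ioi]
    exact ⟨fun h => ⟨h.2, h.1.2⟩, fun h => ⟨⟨hu.1.trans h.1, h.2⟩, h.1⟩⟩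
  have hsqrt : ∀ u ∈ Ioo 0 t, ∀ θ ∈ uIcc 0 (π / 2),
      √(u * (u + (t - u) * sin θ ^ 2 - u)) = √(u * (t - u)) * sin θ := by
    intro u hu θ hθ
    rw [uIcc_of_le (by positivity)] at hθ
    have : 0 ≤ sin θ := sin_nonneg_of_nonneg_of_le_pi hθ.1 (by linarith [hθ.2, pi_pos])
    rw [add_sub_cancel_left, ← mul_assoc,
      sqrt_mul (mul_nonneg hu.1.le (sub_nonneg.2 hu.2.le)), sqrt_sq this]
  have hinner : ∀ G : ℝ → ℝ, ∀ u ∈ Ioo 0 t,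
      ∫ s in Ioo u t, G √(u * (s - u)) * ((√(s - u))⁻¹ * (√(t - s))⁻¹) =
        2 * ∫ θ in (0 : ℝ)..π / 2, G (√(u * (t - u)) * sin θ) := by
    intro G u hu
    rw [setIntegral_mul_inv_sqrt hu.2 (fun s => G √(u * (s - u)))]
    congr 1
    exact integral_congr fun θ hθ => by simp only [hsqrt u hu θ hθ]
  have hΦ : ∀ u ∈ Ioo 0 t, ∫ s in Ioo 0 t, Φ u s =
      2 * (F u * (√u)⁻¹ * ∫ θ in (0 : ℝ)..π / 2, H (√(u * (t - u)) * sin θ)) := by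
    intro u hu
    simp only [Φ]
    rw [setIntegral_indicator measurableSet_Ioi, hcap u hu, MeasureTheory.integral_const_mul,
      hinner H u hu]
    ring
  have hint : Integrable (Function.uncurry Φ)
      ((volume.restrict (Ioo 0 t)).prod (volume.restrict (Ioo 0 t))) := by
    rw [integrable_prod_iff hmeas.aestronglyMeasurable]
    constructor
    · refine (ae_restrict_iff' measurableSet_Ioo).2 (.of_forall fun u hu => ?_)
      simp only [Function.uncurry_apply_pair, Φ]
      rw [integrable_indicator_iff measurableSet_Ioi, IntegrableOn,
        Measure.restrict_restrict measurableSet_Ioi, inter_comm, hcap u hu]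
      exact (integrableOn_mul_inv_sqrt hu.2 (h := fun s => H √(u * (s - u)))
        (by fun_prop)).const_mul _
    · have hcont : Continuous fun u =>
          2 * (|F u| * ∫ θ in (0 : ℝ)..π / 2, |H (√(u * (t - u)) * sin θ)|) := by
        refine continuous_const.mul (hF.abs.mul ?_)
        exact continuous_parametric_intervalIntegral_of_continuous' (by fun_prop) _ _
      have hbase : IntegrableOn (fun u =>
          2 * (|F u| * ∫ θ in (0 : ℝ)..π / 2, |H (√(u * (t - u)) * sin θ)|) * (√u)⁻¹)
          (Ioo 0 t) := by
        have := (intervalIntegrable_inv_sqrt 0 t).continuousOn_mul hcont.continuousOn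
        exact this.1.mono_set Ioo_subset_Ioc_self
      refine hbase.congr_fun (fun u hu => ?_) measurableSet_Ioo
      simp only [Function.uncurry_apply_pair, Φ, norm_indicator_eq_indicator_norm]
      rw [setIntegral_indicator measurableSet_Ioi, hcap u hu]
      have e : ∀ s, ‖g u s‖ =
          |F u| * (√u)⁻¹ * (|H √(u * (s - u))| * ((√(s - u))⁻¹ * (√(t - s))⁻¹)) := by
        intro s
        simp only [g, norm_mul, norm_inv, Real.norm_eq_abs, abs_of_nonneg (sqrt_nonneg _)]
      simp only [e]
      rw [MeasureTheory.integral_const_mul, hinner (fun x => |H x|) u hu]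
      ring
  have hswap := integral_integral_swap hint
  have hzero : ∀ s ∈ Ioo 0 t, ∫ u in Ioo 0 t, Φ u s = (0 : ℝ) := by
    intro s hs
    have e : ∀ u, Φ u s = (Iio s).indicator (fun u =>
        F u * (√u)⁻¹ * (H √(u * (s - u)) * (√(s - u))⁻¹) * (√(t - s))⁻¹) u := by
      intro u
      by_cases h : u < s
      · simp only [Φ, g, indicator_of_mem (mem_Ioi.2 h), indicator_of_mem (mem_Iio.2 h)]
        ring
      · simp [Φ, h]
    have hcap' : Ioo 0 t ∩ Iio s = Ioo 0 s := by
      ext u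
      simp only [mem_inter_iff, mem_Ioo, mem_Iio]
      exact ⟨fun h => ⟨h.1.1, h.2⟩, fun h => ⟨⟨h.1, h.2.trans hs.2⟩, h.2⟩⟩
    simp only [e]
    rw [setIntegral_indicator measurableSet_Iio, hcap', MeasureTheory.integral_mul_const,
      heq s hs, zero_mul]
  rw [setIntegral_congr_fun measurableSet_Ioo hΦ, MeasureTheory.integral_const_mul,
    setIntegral_congr_fun measurableSet_Ioo hzero] at hswap
  simpa using hswap

/-- Uniqueness for a first-kind Volterra equation whose kernel is `N(√(u (t - u)))`. -/
lemma primitive_eq_zero {f N N' : ℝ → ℝ} (hf : ∀ a b, IntervalIntegrable f volume a b)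
    (hfc : ContinuousOn f (Ioi 0)) (hN : ∀ y, HasDerivAt N (N' y) y) (hN' : Continuous N')
    (hN0 : N 0 ≠ 0)
    (heq : ∀ t ∈ Ioc (0 : ℝ) 1, ∫ u in (0 : ℝ)..t, f u * N √(u * (t - u)) = 0) :
    ∀ t ∈ Icc (0 : ℝ) 1, ∫ u in (0 : ℝ)..t, f u = 0 := by
  have hNc : Continuous N := continuous_iff_continuousAt.2 fun y => (hN y).continuousAt
  obtain ⟨C, hC⟩ := (isCompact_Icc (a := (0 : ℝ)) (b := 1)).exists_bound_of_continuousOn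
    hN'.continuousOn
  have hC0 : 0 ≤ C := (norm_nonneg _).trans (hC 0 (by simp))
  have hP : Continuous fun t => ∫ u in (0 : ℝ)..t, f u := continuous_primitive hf 0
  have hN0' : 0 < |N 0| := abs_pos.2 hN0
  refine eqOn_zero_of_abs_le (K := C / |N 0|) hP (by positivity) (by simp) fun t ht => ?_
  set P : ℝ → ℝ := fun t => ∫ u in (0 : ℝ)..t, f u
  let v' : ℝ → ℝ := fun u => N' √(u * (t - u)) * ((t - 2 * u) / (2 * √(u * (t - u))))
  have hv : ∀ u ∈ Ioo 0 t, HasDerivAt (fun u => N √(u * (t - u))) (v' u) u := by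
    intro u hu
    have hpos : 0 < u * (t - u) := mul_pos hu.1 (sub_pos.2 hu.2)
    have h1 : HasDerivAt (fun u => u * (t - u)) (t - 2 * u) u := by
      refine ((hasDerivAt_id' u).fun_mul ((hasDerivAt_id' u).const_sub t)).congr_deriv ?_
      ring
    exact (hN _).comp u (h1.sqrt hpos.ne')
  have hv'bound : ∀ u ∈ Ioo 0 t, |v' u| ≤ C * ((√u)⁻¹ + (√(t - u))⁻¹) := by
    intro u hu
    have htu : 0 < t - u := sub_pos.2 hu.2
    have h1 : |N' √(u * (t - u))| ≤ C := by
      refine hC _ ⟨sqrt_nonneg _, sqrt_le_one.2 ?_⟩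
      nlinarith [ht.2, hu.1, hu.2]
    have h2 : |(t - 2 * u) / (2 * √(u * (t - u)))| ≤ (√u)⁻¹ + (√(t - u))⁻¹ := by
      have p1 : 0 < √u := sqrt_pos.2 hu.1
      have p2 : 0 < √(t - u) := sqrt_pos.2 htu
      have q1 : √u ≤ 1 := sqrt_le_one.2 (by linarith [hu.2, ht.2])
      have q2 : √(t - u) ≤ 1 := sqrt_le_one.2 (by linarith [hu.1, ht.2])
      have s1 := sq_sqrt hu.1.le
      have s2 := sq_sqrt htu.le
      rw [sqrt_mul hu.1.le, abs_div, abs_of_pos (by positivity : 0 < 2 * (√u * √(t - u))),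
        div_le_iff₀ (by positivity)]
      have : ((√u)⁻¹ + (√(t - u))⁻¹) * (2 * (√u * √(t - u))) = 2 * (√(t - u) + √u) := by
        field_simp
      rw [this, abs_le]
      constructor <;> nlinarith
    rw [abs_mul]
    exact mul_le_mul h1 h2 (abs_nonneg _) hC0
  have hk := (intervalIntegrable_inv_sqrt_add le_rfl ht.1.le).const_mul C
  have hv'meas : Measurable v' := by
    have := hN'.measurable
    fun_prop
  have hIoo : ∀ᵐ u ∂volume.restrict (Ioc 0 t), u ∈ Ioo 0 t := by
    rw [← restrict_Ioo_eq_restrict_Ioc]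
    exact ae_restrict_mem measurableSet_Ioo
  have hv'int : IntervalIntegrable v' volume 0 t := by
    refine hk.mono_fun hv'meas.aestronglyMeasurable ?_
    rw [uIoc_of_le ht.1.le]
    filter_upwards [hIoo] with u hu
    exact (hv'bound u hu).trans (le_abs_self _)
  have hibp := integral_mul_deriv_eq_deriv_mul_of_hasDerivAt (a := 0) (b := t) (u := P)
    (v := fun u => N √(u * (t - u))) (u' := f) (v' := v') hP.continuousOn
    (by fun_prop) (fun u hu => ?_) (fun u hu => ?_) (hf 0 t) hv'int
  rotate_left
  · rw [min_eq_left ht.1.le, max_eq_right ht.1.le] at hu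
    exact integral_hasDerivAt_right (hf 0 u)
      (hfc.stronglyMeasurableAtFilter isOpen_Ioi u hu.1) (hfc.continuousAt (Ioi_mem_nhds hu.1))
  · rw [min_eq_left ht.1.le, max_eq_right ht.1.le] at hu
    exact hv u hu
  have hP0 : P 0 = 0 := integral_same
  rw [heq t ht, hP0] at hibp
  simp only [sub_self, mul_zero, sqrt_zero, zero_mul, sub_zero] at hibp
  have hle : |P t| * |N 0| ≤ C * ∫ u in (0 : ℝ)..t, |P u| * ((√u)⁻¹ + (√(t - u))⁻¹) := by
    rw [← abs_mul, ← hibp, ← intervalIntegral.integral_const_mul]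
    refine intervalIntegral.norm_integral_le_of_norm_le (E := ℝ) (f := fun u => P u * v' u) ht.1.le ?_ ?_
    · rw [← ae_restrict_iff' measurableSet_Ioc]
      filter_upwards [hIoo] with u hu
      rw [norm_mul, mul_left_comm]
      exact mul_le_mul_of_nonneg_left (hv'bound u hu) (norm_nonneg _)
    · exact ((intervalIntegrable_inv_sqrt_add le_rfl ht.1.le).continuousOn_mul
        hP.abs.continuousOn).const_mul C
  rw [div_mul_eq_mul_div, le_div_iff₀ hN0']
  exact hle

lemma eqOn_zero_of_continuous {F H : ℝ → ℝ} (hF : Continuous F) (hH : ContDiff ℝ 1 H)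
    (hH0 : H 0 ≠ 0)
    (heq : ∀ s ∈ Ioc (0 : ℝ) 1,
      ∫ u in Ioo 0 s, F u * (√u)⁻¹ * (H √(u * (s - u)) * (√(s - u))⁻¹) = 0) :
    EqOn F 0 (Icc 0 1) := by
  let f : ℝ → ℝ := fun u => F u * (√u)⁻¹
  have hf : ∀ a b, IntervalIntegrable f volume a b := fun a b =>
    (intervalIntegrable_inv_sqrt a b).continuousOn_mul hF.continuousOn
  have hfc : ContinuousOn f (Ioi 0) :=
    hF.continuousOn.mul (continuous_sqrt.continuousOn.inv₀ fun u hu => (sqrt_pos.2 hu).ne')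
  have hH' : Continuous (deriv H) := hH.continuous_deriv le_rfl
  have hprim := primitive_eq_zero hf hfc (hasDerivAt_integral_comp_mul_sin hH)
    (continuous_parametric_intervalIntegral_of_continuous' (by fun_prop) _ _)
    (by simp [hH0, pi_ne_zero]) (fun t ht => by
      rw [integral_of_le ht.1.le, integral_Ioc_eq_integral_Ioo]
      exact setIntegral_abel_eq_zero hF hH.continuous fun s hs =>
        heq s ⟨hs.1, hs.2.le.trans ht.2⟩)
  have hIoo : EqOn F 0 (Ioo 0 1) := by
    intro t ht
    have h1 : HasDerivAt (fun t => ∫ u in (0 : ℝ)..t, f u) (f t) t :=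
      integral_hasDerivAt_right (hf 0 t)
        (hfc.stronglyMeasurableAtFilter isOpen_Ioi t ht.1) (hfc.continuousAt (Ioi_mem_nhds ht.1))
    have h2 : HasDerivAt (fun t => ∫ u in (0 : ℝ)..t, f u) 0 t :=
      (hasDerivAt_const t (0 : ℝ)).congr_of_eventuallyEq <| by
        filter_upwards [Ioo_mem_nhds ht.1 ht.2] with s hs
        exact hprim s ⟨hs.1.le, hs.2.le⟩
    have h3 : F t * (√t)⁻¹ = 0 := h1.unique h2
    exact (mul_eq_zero.1 h3).resolve_right (inv_ne_zero (sqrt_pos.2 ht.1).ne')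
  have := hIoo.closure hF continuous_const
  rwa [closure_Ioo zero_ne_one] at this

/-- Base case `n = 2` of Theorem 2.7: Abel-type kernel `(su-u²)^{-1/2}`. -/
theorem thm_2_7_base (F H : ℝ → ℝ)
    (hF : ContinuousOn F (Icc 0 1)) (hH : ContDiff ℝ (⊤ : ℕ∞) H) (hH0 : H 0 ≠ 0)
    (heq : ∀ s ∈ Ioc (0:ℝ) 1, ∫ u in (0:ℝ)..s,
      F u * H (Real.sqrt (s * u - u ^ 2)) * (s * u - u ^ 2) ^ (-(1:ℝ) / 2) = 0) :
    EqOn F 0 (Icc 0 1) := by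
  have hext : EqOn (IccExtend zero_le_one ((Icc (0 : ℝ) 1).domRestrict F)) F (Icc 0 1) :=
    fun u hu => IccExtend_of_mem _ _ hu
  refine hext.symm.trans (eqOn_zero_of_continuous hF.domRestrict.Icc_extend'
    (hH.of_le (by exact_mod_cast le_top)) hH0 fun s hs => ?_)
  refine Eq.trans ?_ (heq s hs)
  rw [integral_of_le hs.1.le, integral_Ioc_eq_integral_Ioo]
  refine setIntegral_congr_fun measurableSet_Ioo fun u hu => ?_
  have hsu : 0 < s - u := sub_pos.2 hu.2
  have hpow : (s * u - u ^ 2) ^ (-(1 : ℝ) / 2) = (√u)⁻¹ * (√(s - u))⁻¹ := by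
    rw [show s * u - u ^ 2 = u * (s - u) by ring, neg_div, rpow_neg (mul_pos hu.1 hsu).le,
      ← sqrt_eq_rpow, sqrt_mul hu.1.le, mul_inv]
  simp only [hpow]
  simp only [hext ⟨hu.1.le, hu.2.le.trans hs.2⟩,
    show s * u - u ^ 2 = u * (s - u) by ring]
  ring
end
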